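/- Define J : ℝ → ℝ by J θ = ∑_τ P θ τ * ∑_{t : Fin T} r (σ_τ t) (α_τ t). Then J is differentiable and for every θ, deriv J θ = ∑_{t : Fin T} ∑_τ P θ τ * (∑_{i : Fin T, i ≤ t} score θ i τ) * r (σ_τ t) (α_τ t); that is, the policy gradient decomposes over time steps, with the reward at time t paired with the sum of policy scores at times i ≤ t (the prefix-trajectory decomposition of the policy gradient). -/

import Mathlib

open scoped BigOperators

/-- The probability of a full trajectory `τ = (σ, α)` in a finite-horizon MDP:
`P θ τ = init (σ 0) * ∏ i π θ (σ i) (α i) * ∏_{i+1 < T} trans (σ i) (α i) (σ (i+1))`. -/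
noncomputable def Ptraj {S A : Type} [Fintype S] [Fintype A] {T : ℕ} (hT : 1 ≤ T)
    (init : S → ℝ) (trans : S → A → S → ℝ) (π : ℝ → S → A → ℝ)
    (θ : ℝ) (τ : (Fin T → S) × (Fin T → A)) : ℝ :=
  init (τ.1 ⟨0, hT⟩) * (∏ i : Fin T, π θ (τ.1 i) (τ.2 i)) *
    ∏ i : Fin T,
      if h : (i : ℕ) + 1 < T then trans (τ.1 i) (τ.2 i) (τ.1 ⟨(i : ℕ) + 1, h⟩) else 1

/-- The policy score at time `j` along trajectory `τ`. -/
noncomputable def score {S A : Type} {T : ℕ} (π : ℝ → S → A → ℝ)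
    (θ : ℝ) (j : Fin T) (τ : (Fin T → S) × (Fin T → A)) : ℝ :=
  deriv (fun u => Real.log (π u (τ.1 j) (τ.2 j))) θ

/-- The performance objective: expected total return. -/
noncomputable def Jobj {S A : Type} [Fintype S] [Fintype A] {T : ℕ} (hT : 1 ≤ T)
    (init : S → ℝ) (trans : S → A → S → ℝ) (π : ℝ → S → A → ℝ)
    (r : S → A → ℝ) (θ : ℝ) : ℝ :=
  ∑ τ : (Fin T → S) × (Fin T → A),
    Ptraj hT init trans π θ τ * ∑ t : Fin T, r (τ.1 t) (τ.2 t)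

/-- In a finite-horizon process with a time-dependent weight `q` in place of a policy, if the
weight at time `j` sums to zero over actions and all later ones sum to one, then the expectation
of any function of the state and action at a time `t < j` vanishes. -/
theorem sum_trajectory_eq_zero {S A : Type} [Fintype S] [Fintype A]
    (init : S → ℝ) (trans : S → A → S → ℝ) (htrans_sum : ∀ s a, ∑ s', trans s a s' = 1)
    (r : S → A → ℝ) {n : ℕ} (q : Fin (n + 1) → S → A → ℝ) {t j : Fin (n + 1)} (htj : t < j)
    (hj : ∀ s, ∑ a, q j s a = 0) (hq : ∀ i, j < i → ∀ s, ∑ a, q i s a = 1) :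
    ∑ σ : Fin (n + 1) → S, ∑ α : Fin (n + 1) → A,
      init (σ 0) * (∏ i, q i (σ i) (α i)) *
        (∏ i : Fin n, trans (σ i.castSucc) (α i.castSucc) (σ i.succ)) * r (σ t) (α t) = 0 := by
  induction n with
  | zero => omega
  | succ n ih =>
    obtain ⟨t, rfl⟩ : ∃ t' : Fin (n + 1), t = t'.castSucc :=
      ⟨t.castPred (Fin.ne_last_of_lt htj), by simp⟩
    rw [← (Fin.snocEquiv fun _ => S).sum_comp, Fintype.sum_prod_type_right]
    simp_rw [← (Fin.snocEquiv fun _ : Fin (n + 2) => A).sum_comp, Fintype.sum_prod_type_right]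
    have key : ∀ (σ : Fin (n + 1) → S) (s : S) (α : Fin (n + 1) → A) (a : A),
        init ((Fin.snocEquiv fun _ => S) (s, σ) 0) *
          (∏ i, q i ((Fin.snocEquiv fun _ => S) (s, σ) i)
            ((Fin.snocEquiv fun _ => A) (a, α) i)) *
          (∏ i : Fin (n + 1), trans ((Fin.snocEquiv fun _ => S) (s, σ) i.castSucc)
            ((Fin.snocEquiv fun _ => A) (a, α) i.castSucc)
            ((Fin.snocEquiv fun _ => S) (s, σ) i.succ)) *
          r ((Fin.snocEquiv fun _ => S) (s, σ) t.castSucc)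
            ((Fin.snocEquiv fun _ => A) (a, α) t.castSucc) =
        (init (σ 0) * (∏ i, q i.castSucc (σ i) (α i)) *
          (∏ i : Fin n, trans (σ i.castSucc) (α i.castSucc) (σ i.succ)) * r (σ t) (α t)) *
          trans (σ (Fin.last n)) (α (Fin.last n)) s * q (Fin.last (n + 1)) s a := by
      intro σ s α a
      have h0 : (Fin.snoc σ s : Fin (n + 2) → S) 0 = σ 0 :=
        Fin.snoc_castSucc (α := fun _ => S) s σ 0
      simp only [Fin.snocEquiv_apply, Fin.prod_univ_castSucc (n := n + 1),
        Fin.prod_univ_castSucc (n := n), Fin.snoc_castSucc, Fin.snoc_last, Fin.succ_last,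
        Fin.succ_castSucc, h0]
      ring
    simp_rw [key, ← Finset.mul_sum]
    induction j using Fin.lastCases with
    | last => simp [hj]
    | cast j =>
      simp_rw [hq _ (Fin.castSucc_lt_last j), mul_one]
      calc _ = ∑ σ : Fin (n + 1) → S, ∑ α : Fin (n + 1) → A,
            init (σ 0) * (∏ i, q i.castSucc (σ i) (α i)) *
              (∏ i : Fin n, trans (σ i.castSucc) (α i.castSucc) (σ i.succ)) *
              r (σ t) (α t) := by
            refine Finset.sum_congr rfl fun σ _ => ?_
            rw [Finset.sum_comm]
            simp_rw [← Finset.mul_sum, htrans_sum, mul_one]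
        _ = 0 := ih (fun i => q i.castSucc) (Fin.castSucc_lt_castSucc_iff.1 htj) hj
            fun i hi => hq _ (Fin.castSucc_lt_castSucc_iff.2 hi)

/-- Under a smooth policy the score has zero mean over actions. -/
theorem sum_mul_deriv_log_eq_zero {A : Type} [Fintype A] {p : ℝ → A → ℝ}
    (hpos : ∀ θ a, 0 < p θ a) (hsum : ∀ θ, ∑ a, p θ a = 1)
    (hdiff : ∀ a, Differentiable ℝ fun θ => p θ a) (θ : ℝ) :
    ∑ a, p θ a * deriv (fun u => Real.log (p u a)) θ = 0 := by
  have h (a : A) : p θ a * deriv (fun u => Real.log (p u a)) θ = deriv (fun u => p u a) θ := by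
    rw [deriv.log (hdiff a θ) (hpos θ a).ne', mul_div_cancel₀ _ (hpos θ a).ne']
  simp_rw [h]
  rw [← deriv_fun_sum fun a _ => hdiff a θ]
  simp [hsum]

/-- A reward collected at time `t` is uncorrelated with the score at any later time. -/
theorem sum_Ptraj_mul_score_mul_eq_zero {S A : Type} [Fintype S] [Fintype A]
    {T : ℕ} (hT : 1 ≤ T) (init : S → ℝ)
    (trans : S → A → S → ℝ) (htrans_sum : ∀ s a, ∑ s', trans s a s' = 1)
    (r : S → A → ℝ) {π : ℝ → S → A → ℝ}
    (hπ_pos : ∀ θ s a, 0 < π θ s a) (hπ_sum : ∀ θ s, ∑ a, π θ s a = 1)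
    (hπ_diff : ∀ s a, Differentiable ℝ (fun θ => π θ s a)) (θ : ℝ) {t j : Fin T} (htj : t < j) :
    ∑ τ : (Fin T → S) × (Fin T → A),
      Ptraj hT init trans π θ τ * score π θ j τ * r (τ.1 t) (τ.2 t) = 0 := by
  obtain ⟨n, rfl⟩ := Nat.exists_eq_add_of_le' hT
  have hmean (s : S) := sum_mul_deriv_log_eq_zero (fun θ => hπ_pos θ s) (fun θ => hπ_sum θ s)
    (hπ_diff s) θ
  rw [Fintype.sum_prod_type, ← sum_trajectory_eq_zero init trans htrans_sum r
    (fun i (s : S) (a : A) => π θ s a * if i = j then deriv (fun u => Real.log (π u s a)) θ else 1) htj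
    (fun s => by simpa using hmean s)
    (fun i hi s => by simp [hi.ne', hπ_sum])]
  refine Finset.sum_congr rfl fun σ _ => Finset.sum_congr rfl fun α _ => ?_
  simp only [Ptraj, score, Finset.prod_mul_distrib, Finset.prod_ite_eq', Finset.mem_univ, if_true]
  rw [Fin.prod_univ_castSucc (n := n) (f := fun i : Fin (n + 1) => dite _ _ _)]
  simp only [Fin.val_castSucc, Fin.val_last, lt_irrefl, dite_false, mul_one, Fin.is_lt,
    add_lt_add_iff_right, dite_true]
  rw [show (⟨0, hT⟩ : Fin (n + 1)) = 0 from rfl]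
  simp only [Fin.succ, mul_assoc]
  ring

/-- The log-derivative identity for the probability of a trajectory. -/
theorem hasDerivAt_Ptraj {S A : Type} [Fintype S] [Fintype A]
    {T : ℕ} (hT : 1 ≤ T) (init : S → ℝ) (trans : S → A → S → ℝ) {π : ℝ → S → A → ℝ}
    (hπ_pos : ∀ θ s a, 0 < π θ s a)
    (hπ_diff : ∀ s a, Differentiable ℝ (fun θ => π θ s a)) (θ : ℝ)
    (τ : (Fin T → S) × (Fin T → A)) :
    HasDerivAt (fun u => Ptraj hT init trans π u τ)
      (Ptraj hT init trans π θ τ * ∑ i, score π θ i τ) θ := by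
  unfold Ptraj
  have h := HasDerivAt.fun_finsetProd (u := Finset.univ)
    (f := fun (i : Fin T) u => π u (τ.1 i) (τ.2 i)) (x := θ)
    fun i _ => (hπ_diff (τ.1 i) (τ.2 i) θ).hasDerivAt
  refine ((h.const_mul (init (τ.1 ⟨0, hT⟩))).mul_const _).congr_deriv (Eq.symm ?_)
  rw [mul_right_comm, mul_assoc (init _), Finset.mul_sum]
  congr 2
  refine Finset.sum_congr rfl fun i _ => ?_
  rw [score, deriv.log (hπ_diff _ _ θ) (hπ_pos θ _ _).ne',
    ← Finset.prod_erase_mul _ _ (Finset.mem_univ i), smul_eq_mul, mul_assoc,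
    mul_div_cancel₀ _ (hπ_pos θ _ _).ne']

/-- The prefix-trajectory decomposition of the policy gradient: `J` is
differentiable and its derivative decomposes over time steps, with the reward
at time `t` paired with the sum of policy scores at times `i ≤ t`. -/
theorem policy_gradient_prefix_decomposition
    {S A : Type} [Fintype S] [Fintype A] [Nonempty S] [Nonempty A]
    {T : ℕ} (hT : 1 ≤ T)
    (init : S → ℝ) (hinit_nonneg : ∀ s, 0 ≤ init s) (hinit_sum : ∑ s, init s = 1)
    (trans : S → A → S → ℝ) (htrans_nonneg : ∀ s a s', 0 ≤ trans s a s')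
    (htrans_sum : ∀ s a, ∑ s', trans s a s' = 1)
    (r : S → A → ℝ)
    (π : ℝ → S → A → ℝ)
    (hπ_pos : ∀ θ s a, 0 < π θ s a)
    (hπ_sum : ∀ θ s, ∑ a, π θ s a = 1)
    (hπ_diff : ∀ s a, Differentiable ℝ (fun θ => π θ s a)) :
    Differentiable ℝ (Jobj hT init trans π r) ∧
      ∀ θ : ℝ,
        deriv (Jobj hT init trans π r) θ =
          ∑ t : Fin T, ∑ τ : (Fin T → S) × (Fin T → A),
            Ptraj hT init trans π θ τ *
              (∑ i ∈ Finset.univ.filter (fun i : Fin T => i ≤ t), score π θ i τ) *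
              r (τ.1 t) (τ.2 t) := by
  have hJ (θ : ℝ) := HasDerivAt.fun_sum (u := Finset.univ) fun τ _ =>
    (hasDerivAt_Ptraj hT init trans hπ_pos hπ_diff θ τ).mul_const (∑ t, r (τ.1 t) (τ.2 t))
  refine ⟨fun θ => (hJ θ).differentiableAt, fun θ => (hJ θ).deriv.trans ?_⟩
  refine (Finset.sum_congr rfl fun τ _ => Finset.mul_sum _ _ _).trans ?_
  rw [Finset.sum_comm]
  refine Finset.sum_congr rfl fun t _ => ?_
  simp_rw [← Finset.sum_filter_add_sum_filter_not Finset.univ (· ≤ t), mul_add, add_mul,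
    Finset.sum_add_distrib]
  rw [add_eq_left]
  simp_rw [Finset.mul_sum, Finset.sum_mul]
  rw [Finset.sum_comm]
  refine Finset.sum_eq_zero fun j hj => ?_
  exact sum_Ptraj_mul_score_mul_eq_zero hT init trans htrans_sum r hπ_pos hπ_sum hπ_diff θ
    (not_le.1 (Finset.mem_filter.1 hj).2)
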